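/- Every vector of squared length 2 in Q_Fib lies in the W_Fib-orbit of β₁ or in the W_Fib-orbit of β₂ (so π(Δ₀^re) = Δ^re = W_Fib·β₁ ∪ W_Fib·β₂). Equivalently in coordinates: every (n₁,n₂) ∈ ℤ² with n₁² - 3n₁n₂ + n₂² = 1 lies in the orbit of (1,0) or of (0,1) under the group generated by r₁ : (n₁,n₂) ↦ (3n₂ - n₁, n₂) and r₂ : (n₁,n₂) ↦ (n₁, 3n₁ - n₂). -/

import Mathlib

/-! Statement 14: every vector of squared length 2 in Q_Fib lies in the W_Fib-orbit of β₁
or of β₂. In (β₁,β₂)-coordinates, the squared length of n₁β₁+n₂β₂ is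
2(n₁² - 3n₁n₂ + n₂²), and the simple reflections act by r₁(n₁,n₂) = (3n₂-n₁, n₂) and
r₂(n₁,n₂) = (n₁, 3n₁-n₂). -/

/-- The simple reflection r₁ in (β₁,β₂)-coordinates. -/
def r₁ : Function.End (ℤ × ℤ) := fun n => (3 * n.2 - n.1, n.2)

/-- The simple reflection r₂ in (β₁,β₂)-coordinates. -/
def r₂ : Function.End (ℤ × ℤ) := fun n => (n.1, 3 * n.1 - n.2)

/-- The Fib Weyl group W_Fib: the collection of self-maps of ℤ² generated by r₁ and r₂
under composition (a group, since r₁ and r₂ are involutions). -/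
def WFib : Submonoid (Function.End (ℤ × ℤ)) := Submonoid.closure {r₁, r₂}

/-- If `r` is an involution in `WFib`
and `r n` lies in one of the orbits, so does `n`. -/
theorem exists_mem_WFib_of_involutive {r : Function.End (ℤ × ℤ)} (hr : r ∈ WFib)
    (hinv : Function.Involutive r) {n : ℤ × ℤ}
    (h : ∃ w ∈ WFib, r n = w ((1 : ℤ), (0 : ℤ)) ∨ r n = w ((0 : ℤ), (1 : ℤ))) :
    ∃ w ∈ WFib, n = w ((1 : ℤ), (0 : ℤ)) ∨ n = w ((0 : ℤ), (1 : ℤ)) := by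
  obtain ⟨w, hw, h⟩ := h
  refine ⟨r * w, mul_mem hr hw, h.imp (fun e => ?_) (fun e => ?_)⟩ <;>
    exact (hinv n).symm.trans (congrArg r e)

theorem r₁_mem_WFib : r₁ ∈ WFib := Submonoid.subset_closure (Or.inl rfl)

theorem r₂_mem_WFib : r₂ ∈ WFib := Submonoid.subset_closure (Or.inr rfl)

theorem r₁_involutive : Function.Involutive r₁ := fun n => by ext <;> simp [r₁]

theorem r₂_involutive : Function.Involutive r₂ := fun n => by ext <;> simp [r₂]

/-- Reflecting in the larger coordinate of a real root strictly decreases it, since the product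
of the old and the new value is `b ^ 2 - 1`. -/
theorem natAbs_reflection_lt {a b : ℤ} (h : a ^ 2 - 3 * a * b + b ^ 2 = 1) (hb : b ≠ 0)
    (hab : b.natAbs ≤ a.natAbs) : (3 * b - a).natAbs < a.natAbs := by
  have hprod : (3 * b - a) * a = b ^ 2 - 1 := by linear_combination -h
  have hb1 : 1 ≤ b ^ 2 := by
    have : 0 < b ^ 2 := by positivity
    omega
  have hsq : b ^ 2 ≤ a ^ 2 := Int.natAbs_le_iff_sq_le.mp hab
  have habs : |3 * b - a| * |a| < |a| * |a| := by
    rw [← abs_mul, hprod, abs_of_nonneg (by linarith), abs_mul_abs_self]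
    linarith
  have hlt := lt_of_mul_lt_mul_right habs (abs_nonneg a)
  rwa [Int.abs_eq_natAbs, Int.abs_eq_natAbs, Nat.cast_lt] at hlt

/-- Every (n₁,n₂) ∈ ℤ² with n₁² - 3n₁n₂ + n₂² = 1 lies in the W_Fib-orbit of (1,0)
(i.e. of β₁) or of (0,1) (i.e. of β₂). -/
theorem real_roots_two_orbits (n : ℤ × ℤ)
    (h : n.1 ^ 2 - 3 * n.1 * n.2 + n.2 ^ 2 = 1) :
    ∃ w ∈ WFib, n = w ((1 : ℤ), (0 : ℤ)) ∨ n = w ((0 : ℤ), (1 : ℤ)) := by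
  induction hk : n.1.natAbs + n.2.natAbs using Nat.strong_induction_on generalizing n with
  | _ k ih =>
    obtain ⟨a, b⟩ := n
    dsimp only at h hk
    by_cases hb : b = 0
    · subst hb
      have ha : a = 1 ∨ a = -1 := sq_eq_one_iff.mp (by linear_combination h)
      rcases ha with rfl | rfl
      · exact ⟨1, one_mem _, Or.inl rfl⟩
      · exact ⟨r₁, r₁_mem_WFib, Or.inl rfl⟩
    by_cases ha : a = 0
    · subst ha
      have hb' : b = 1 ∨ b = -1 := sq_eq_one_iff.mp (by linear_combination h)
      rcases hb' with rfl | rfl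
      · exact ⟨1, one_mem _, Or.inr rfl⟩
      · exact ⟨r₂, r₂_mem_WFib, Or.inr rfl⟩
    rcases le_total b.natAbs a.natAbs with hab | hab
    · have hlt := natAbs_reflection_lt h hb hab
      refine exists_mem_WFib_of_involutive r₁_mem_WFib r₁_involutive
        (ih _ ?_ (r₁ (a, b)) ?_ rfl)
      · simp only [r₁]
        omega
      · simp only [r₁]
        linear_combination h
    · have hlt := natAbs_reflection_lt (a := b) (b := a) (by linear_combination h) ha hab
      refine exists_mem_WFib_of_involutive r₂_mem_WFib r₂_involutive
        (ih _ ?_ (r₂ (a, b)) ?_ rfl)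
      · simp only [r₂]
        omega
      · simp only [r₂]
        linear_combination h
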